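/- Let D be a data set with n ≥ 2 pairwise distinct observations. Then for all sufficiently small ε (with L/ε an integer), every optimal histogram for D on the ε-grid is the trivial single-interval histogram M = (1, {x_min − ε/2, x_max + ε/2}, n). -/

import Mathlib

open Real Finset

/-- Rissanen's universal code length for integers:
`log*(K) = log₂(2.865) + Σ_{j≥1} max(log₂^{(j)}(K), 0)`. -/
noncomputable def logStar (K : ℕ) : ℝ :=
  Real.logb 2 2.865 + ∑' j : ℕ, max ((fun x => Real.logb 2 x)^[j + 1] (K : ℝ)) 0

/-- A histogram model on the ε-grid built on the data range `[xmin, xmax]`,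
with `E` elementary ε-bins.  Intervals are `]c k, c (k+1)]` for `k < K`, with
count `h k`; the counts sum to `n`. -/
structure Histogram (n : ℕ) (ε xmin xmax : ℝ) (E : ℕ) where
  K : ℕ
  c : ℕ → ℝ
  h : ℕ → ℕ
  K_pos : 1 ≤ K
  c_mono : ∀ k < K, c k ≤ c (k + 1)
  c_first : c 0 = xmin - ε / 2
  c_last : c K = xmax + ε / 2
  c_grid : ∀ k ≤ K, ∃ t : ℕ, t ≤ E ∧ c k = xmin - ε / 2 + t * ε
  h_sum : ∑ k ∈ Finset.range K, h k = n

namespace Histogram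

variable {n : ℕ} {ε xmin xmax : ℝ} {E : ℕ}

open Classical in
/-- Compatibility of a histogram with a data set: the count of each
interval matches the number of observations that fall in it. -/
def Compatible (D : Fin n → ℝ) (M : Histogram n ε xmin xmax E) : Prop :=
  ∀ k < M.K,
    (Finset.univ.filter fun i => D i ∈ Set.Ioc (M.c k) (M.c (k + 1))).card = M.h k

/-- The Enum MDL criterion for histogram selection. -/
noncomputable def cEnum (M : Histogram n ε xmin xmax E) : ℝ :=
  logStar M.K + Real.log (Nat.choose (E + M.K - 1) (M.K - 1))
    + Real.log (Nat.choose (n + M.K - 1) (M.K - 1))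
    + (Real.log (Nat.factorial n)
        - ∑ k ∈ Finset.range M.K, Real.log (Nat.factorial (M.h k)))
    + ∑ k ∈ Finset.range M.K, (M.h k : ℝ) * Real.log ((M.c (k + 1) - M.c k) / ε)

/-- A histogram is optimal for `D` if it is compatible with `D` and minimizes
the Enum criterion among all compatible histograms on the same grid. -/
def Optimal (D : Fin n → ℝ) (M : Histogram n ε xmin xmax E) : Prop :=
  M.Compatible D ∧
    ∀ M' : Histogram n ε xmin xmax E, M'.Compatible D → M.cEnum ≤ M'.cEnum

end Histogram

lemma core_caseA (n : ℕ) (c : ℝ) (hc : 0 < c) (hc1 : c ≤ 1) (E : ℕ) (hE0 : 0 < E)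
    (hE : ((n + 1).factorial : ℝ) < c ^ n * E) (K : ℕ) (h e : ℕ → ℕ)
    (hs : ∑ k ∈ range K, h k = n)
    (h1 : ∀ k < K, 1 ≤ h k → 1 ≤ e k) (h2 : ∀ k < K, 2 ≤ h k → c * E ≤ e k)
    (hK : ((range K).filter (fun k => h k = 1)).card + 2 ≤ K) :
    (E : ℝ) ^ n * ∏ k ∈ range K, ((h k).factorial : ℝ) <
      ((E + K - 1).choose (K - 1) : ℝ) * ((n + K - 1).choose (K - 1) : ℝ) * (n.factorial : ℝ)
        * ∏ k ∈ range K, (e k : ℝ) ^ h k := by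
  set m := ((range K).filter (fun k => h k = 1)).card with hm
  have hER : (0 : ℝ) < E := by exact_mod_cast hE0
  -- split of n
  have hn : n = m + ∑ k ∈ range K, (if 2 ≤ h k then h k else 0) := by
    rw [hm, card_filter, ← sum_add_distrib, ← hs]
    apply sum_congr rfl
    intro k _
    split_ifs <;> omega
  set s := ∑ k ∈ range K, (if 2 ≤ h k then h k else 0) with hsdef
  have hfact : ∏ k ∈ range K, ((h k).factorial : ℝ) ≤ n.factorial := by
    have := Nat.le_of_dvd (Nat.factorial_pos _) (Nat.prod_factorial_dvd_factorial_sum (range K) h)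
    rw [hs] at this
    exact_mod_cast this
  have hprod : c ^ n * (E : ℝ) ^ s ≤ ∏ k ∈ range K, (e k : ℝ) ^ h k := by
    calc c ^ n * (E : ℝ) ^ s ≤ c ^ s * (E : ℝ) ^ s := by
          gcongr ?_ * _
          exact pow_le_pow_of_le_one hc.le hc1 (by omega)
      _ = ∏ k ∈ range K, (c * E) ^ (if 2 ≤ h k then h k else 0) := by
          rw [prod_pow_eq_pow_sum, mul_pow]
      _ ≤ _ := by
          apply prod_le_prod
          · intros; positivity
          · intro k hk
            rw [mem_range] at hk
            split_ifs with h3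
            · exact pow_le_pow_left₀ (by positivity) (h2 k hk h3) _
            · rw [pow_zero]
              by_cases h0 : h k = 0
              · simp [h0]
              · apply one_le_pow₀
                exact_mod_cast h1 k hk (by omega)
  have hch : (E : ℝ) ^ (m + 1) ≤ ((n + 1).factorial : ℝ) * ((E + K - 1).choose (K - 1) : ℝ) := by
    have a1 : (E + 1) ^ (m + 1) ≤ (m + 1).factorial * (E + m + 1).choose (m + 1) := by
      have := Nat.pow_sub_le_descFactorial (E + m + 1) (m + 1)
      rwa [show E + m + 1 + 1 - (m + 1) = E + 1 by omega,
        Nat.descFactorial_eq_factorial_mul_choose] at this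
    have a2 : (E + m + 1).choose (m + 1) ≤ (E + K - 1).choose (K - 1) := by
      have e1 : (E + m + 1).choose (m + 1) = (E + m + 1).choose E := by
        rw [← Nat.choose_symm_of_eq_add]; omega
      have e2 : (E + K - 1).choose (K - 1) = (E + K - 1).choose E := by
        rw [← Nat.choose_symm_of_eq_add]; omega
      rw [e1, e2]
      exact Nat.choose_le_choose _ (by omega)
    have a3 : (m + 1).factorial ≤ (n + 1).factorial := Nat.factorial_le (by omega)
    have a4 : E ^ (m + 1) ≤ (E + 1) ^ (m + 1) := Nat.pow_le_pow_left (by omega) _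
    have : E ^ (m + 1) ≤ (n + 1).factorial * (E + K - 1).choose (K - 1) :=
      a4.trans (a1.trans (Nat.mul_le_mul a3 a2))
    exact_mod_cast this
  have hch2 : (1 : ℝ) ≤ ((n + K - 1).choose (K - 1) : ℝ) := by
    exact_mod_cast Nat.choose_pos (by omega)
  set A := ((E + K - 1).choose (K - 1) : ℝ)
  set B := ((n + K - 1).choose (K - 1) : ℝ)
  have hF : (0 : ℝ) < (n + 1).factorial := by positivity
  have hnf : (0 : ℝ) < n.factorial := by positivity
  have hA : 0 ≤ A := by positivity
  refine lt_of_mul_lt_mul_left (a := ((n + 1).factorial : ℝ)) ?_ hF.le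
  calc ((n + 1).factorial : ℝ) * ((E : ℝ) ^ n * ∏ k ∈ range K, ((h k).factorial : ℝ))
      ≤ ((n + 1).factorial : ℝ) * ((E : ℝ) ^ n * n.factorial) := by gcongr
    _ < (c ^ n * E) * ((E : ℝ) ^ n * n.factorial) := by gcongr
    _ = (E : ℝ) ^ (m + 1) * 1 * n.factorial * (c ^ n * (E : ℝ) ^ s) := by
        have : (E : ℝ) ^ n = (E : ℝ) ^ m * (E : ℝ) ^ s := by rw [← pow_add, ← hn]
        rw [this]; ring
    _ ≤ (((n + 1).factorial : ℝ) * A) * B * n.factorial *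
        ∏ k ∈ range K, (e k : ℝ) ^ h k := by gcongr
    _ = _ := by ring

lemma core_caseB (n : ℕ) (hn2 : 2 ≤ n) (c : ℝ) (hc : 0 < c) (hcn : c * (2 * n ^ 2) ≤ 1)
    (E : ℕ) (hE0 : 0 < E)
    (hE : 1 < c ^ (n + 1) * E) (K : ℕ) (hK2 : 2 ≤ K) (h e : ℕ → ℕ)
    (hs : ∑ k ∈ range K, h k = n) (he : ∑ k ∈ range K, e k = E)
    (h1 : ∀ k < K, 1 ≤ h k → 1 ≤ e k) (h2 : ∀ k < K, 2 ≤ h k → c * E ≤ e k)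
    (k0 : ℕ) (hk0 : k0 < K) (ho : ∀ k < K, k ≠ k0 → h k = 1)
    (hmax : h k0 = 1 → ∀ k < K, e k ≤ e k0) :
    (E : ℝ) ^ n * ∏ k ∈ range K, ((h k).factorial : ℝ) <
      ((E + K - 1).choose (K - 1) : ℝ) * ((n + K - 1).choose (K - 1) : ℝ) * (n.factorial : ℝ)
        * ∏ k ∈ range K, (e k : ℝ) ^ h k := by
  have hER : (0 : ℝ) < E := by exact_mod_cast hE0
  have hmem : k0 ∈ range K := mem_range.2 hk0
  set T := (range K).erase k0 with hT
  have hTmem : ∀ k ∈ T, k < K ∧ k ≠ k0 := by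
    intro k hk
    rw [hT, mem_erase, mem_range] at hk
    exact ⟨hk.2, hk.1⟩
  have hTcard : T.card = K - 1 := by rw [hT, card_erase_of_mem hmem, card_range]
  obtain ⟨m, rfl⟩ : ∃ m, K = m + 1 := ⟨K - 1, by omega⟩
  simp only [Nat.add_sub_cancel] at hTcard
  have hm1 : 1 ≤ m := by omega
  set r := h k0 with hr
  have hrm : r + m = n := by
    rw [← hs, ← add_sum_erase _ _ hmem, ← hT, sum_congr rfl (fun k hk => ho k (hTmem k hk).1 (hTmem k hk).2)]
    simp [hTcard, hr]
  have hpf : ∏ k ∈ range (m + 1), ((h k).factorial : ℝ) = r.factorial := by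
    rw [← mul_prod_erase _ _ hmem, ← hT, prod_eq_one (s := T), mul_one]
    intro k hk
    simp [ho k (hTmem k hk).1 (hTmem k hk).2]
  have hpe : ∏ k ∈ range (m + 1), (e k : ℝ) ^ h k = (e k0 : ℝ) ^ r * ∏ k ∈ T, (e k : ℝ) := by
    rw [← mul_prod_erase _ _ hmem, ← hT]
    congr 1
    apply prod_congr rfl
    intro k hk
    rw [ho k (hTmem k hk).1 (hTmem k hk).2, pow_one]
  have hT1 : ∀ k ∈ T, (1 : ℝ) ≤ e k := by
    intro k hk
    exact_mod_cast h1 k (hTmem k hk).1 (by rw [ho k (hTmem k hk).1 (hTmem k hk).2])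
  have hTsum : (e k0 : ℝ) + ∑ k ∈ T, (e k : ℝ) = E := by
    rw [← he, ← add_sum_erase _ _ hmem]; push_cast; rfl
  rw [hpf, hpe]
  simp only [← Nat.add_assoc, Nat.add_sub_cancel]
  have hch : (E : ℝ) ^ m ≤ (m.factorial : ℝ) * ((E + m).choose m : ℝ) := by
    have a1 : (E + 1) ^ m ≤ m.factorial * (E + m).choose m := by
      have := Nat.pow_sub_le_descFactorial (E + m) m
      rwa [show E + m + 1 - m = E + 1 by omega,
        Nat.descFactorial_eq_factorial_mul_choose] at this
    have a4 : E ^ m ≤ (E + 1) ^ m := Nat.pow_le_pow_left (by omega) _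
    exact_mod_cast a4.trans a1
  have hch2 : (3 : ℝ) ≤ ((n + m).choose m : ℝ) := by
    have e2 : (n + m).choose m = (n + m).choose n := by
      rw [← Nat.choose_symm_of_eq_add]; omega
    have : (n + 1).choose n ≤ (n + m).choose n := Nat.choose_le_choose _ (by omega)
    rw [Nat.choose_succ_self_right] at this
    rw [e2]
    exact_mod_cast (show 3 ≤ (n + m).choose n by omega)
  have hff : (m.factorial : ℝ) * r.factorial ≤ n.factorial := by
    have := Nat.le_of_dvd (Nat.factorial_pos _) (Nat.factorial_mul_factorial_dvd_factorial_add m r)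
    rw [add_comm m r, hrm] at this
    exact_mod_cast this
  have hEn : (E : ℝ) ^ n = (E : ℝ) ^ m * (E : ℝ) ^ r := by rw [← pow_add, add_comm, hrm]
  set A := ((E + m).choose m : ℝ)
  set B := ((n + m).choose m : ℝ)
  have hA : 0 ≤ A := by positivity
  have hmf : (0 : ℝ) < m.factorial := by positivity
  have hnf : (0 : ℝ) < n.factorial := by positivity
  have hnR : (2 : ℝ) ≤ n := by exact_mod_cast hn2
  -- key bound
  have key : (E : ℝ) ^ r < 3 * ((e k0 : ℝ) ^ r * ∏ k ∈ T, (e k : ℝ)) := by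
    by_cases hb : (1 - 1 / (2 * n)) * (E : ℝ) ≤ e k0
    · have hP : 1 ≤ ∏ k ∈ T, (e k : ℝ) := by
        calc (1 : ℝ) = ∏ k ∈ T, (1 : ℝ) := by simp
          _ ≤ _ := prod_le_prod (by intros; norm_num) hT1
      have hq : (1 : ℝ) / (2 * n) ≤ 1 / 4 := by
        apply one_div_le_one_div_of_le <;> linarith
      have hq0 : (0 : ℝ) < 1 / (2 * n) := by positivity
      have hbern : (1 : ℝ) / 2 ≤ (1 - 1 / (2 * n)) ^ r := by
        calc (1 : ℝ) / 2 = 1 + n * (-(1 / (2 * n))) := by field_simp; ring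
          _ ≤ (1 + (-(1 / (2 * n)))) ^ n := one_add_mul_le_pow (by linarith) n
          _ = (1 - 1 / (2 * n)) ^ n := by rw [← sub_eq_add_neg]
          _ ≤ _ := pow_le_pow_of_le_one (by linarith) (by linarith) (by omega)
      have hEr : (0 : ℝ) < (E : ℝ) ^ r := by positivity
      have : (1 : ℝ) / 2 * E ^ r * 1 ≤ (e k0 : ℝ) ^ r * ∏ k ∈ T, (e k : ℝ) := by
        gcongr
        calc (1 : ℝ) / 2 * E ^ r ≤ (1 - 1 / (2 * n)) ^ r * E ^ r := by gcongr
          _ = ((1 - 1 / (2 * n)) * E) ^ r := by rw [mul_pow]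
          _ ≤ _ := by
            apply pow_le_pow_left₀ _ hb
            apply mul_nonneg _ hER.le
            linarith
      linarith
    · push Not at hb
      obtain ⟨k1, hk1, hk1e⟩ : ∃ k ∈ T, c * E ≤ e k := by
        by_contra! hcon
        have hle : ∑ k ∈ T, (e k : ℝ) ≤ ∑ k ∈ T, c * E := sum_le_sum fun k hk => (hcon k hk).le
        rw [sum_const, hTcard, nsmul_eq_mul] at hle
        have hmn : (m : ℝ) ≤ n := by exact_mod_cast (show m ≤ n by omega)
        have : (m : ℝ) * (c * E) ≤ n * (c * E) := by gcongr
        have h5 : n * c ≤ 1 / (2 * n) := by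
          rw [le_div_iff₀ (by positivity)]; nlinarith
        have h6 : n * c * E ≤ 1 / (2 * n) * E := by gcongr
        linarith
      have hP : c * E ≤ ∏ k ∈ T, (e k : ℝ) := by
        rw [← mul_prod_erase _ _ hk1]
        have : (1 : ℝ) ≤ ∏ k ∈ T.erase k1, (e k : ℝ) := by
          calc (1 : ℝ) = ∏ k ∈ T.erase k1, (1 : ℝ) := by simp
            _ ≤ _ := prod_le_prod (by intros; norm_num) (fun k hk => hT1 k (mem_of_mem_erase hk))
        calc c * E = c * E * 1 := by ring
          _ ≤ _ := by gcongr
      have hc1 : c ≤ 1 := by nlinarith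
      have hp0 : c ^ n * (E : ℝ) ^ r ≤ (e k0 : ℝ) ^ r := by
        calc c ^ n * (E : ℝ) ^ r ≤ c ^ r * (E : ℝ) ^ r := by
              gcongr ?_ * _
              exact pow_le_pow_of_le_one hc.le hc1 (by omega)
          _ = (c * E) ^ r := by rw [mul_pow]
          _ ≤ _ := by
            rcases Nat.eq_zero_or_pos r with h0 | h0
            · simp [h0]
            apply pow_le_pow_left₀ (by positivity)
            rcases Nat.lt_or_ge r 2 with h3 | h3
            · have := hmax (by omega) k1 (hTmem k1 hk1).1
              exact hk1e.trans (by exact_mod_cast this)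
            · exact h2 k0 hk0 h3
      have hEr : (0 : ℝ) < (E : ℝ) ^ r := by positivity
      have : c ^ n * (E : ℝ) ^ r * (c * E) ≤ (e k0 : ℝ) ^ r * ∏ k ∈ T, (e k : ℝ) := by gcongr
      have h7 : 1 * (E : ℝ) ^ r < c ^ (n + 1) * E * (E : ℝ) ^ r := by gcongr
      have h8 : c ^ (n + 1) * E * (E : ℝ) ^ r = c ^ n * (E : ℝ) ^ r * (c * E) := by ring
      linarith
  set P := (e k0 : ℝ) ^ r * ∏ k ∈ T, (e k : ℝ)
  have hP0 : 0 ≤ P := by positivity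
  refine lt_of_mul_lt_mul_left (a := (m.factorial : ℝ)) ?_ hmf.le
  have hEm : (0 : ℝ) < (E : ℝ) ^ m := by positivity
  calc (m.factorial : ℝ) * ((E : ℝ) ^ n * r.factorial)
      = (E : ℝ) ^ m * (m.factorial * r.factorial) * (E : ℝ) ^ r := by rw [hEn]; ring
    _ ≤ (E : ℝ) ^ m * n.factorial * (E : ℝ) ^ r := by gcongr
    _ < (E : ℝ) ^ m * n.factorial * (3 * P) := by gcongr
    _ = (E : ℝ) ^ m * 3 * n.factorial * P := by ring
    _ ≤ (m.factorial * A) * B * n.factorial * P := by gcongr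
    _ = _ := by ring

lemma core (n : ℕ) (hn2 : 2 ≤ n) (c : ℝ) (hc : 0 < c) (hcn : c * (2 * n ^ 2) ≤ 1)
    (E : ℕ) (hE0 : 0 < E)
    (hE : ((n + 1).factorial : ℝ) < c ^ (n + 1) * E) (K : ℕ) (hK2 : 2 ≤ K) (h e : ℕ → ℕ)
    (hs : ∑ k ∈ range K, h k = n) (he : ∑ k ∈ range K, e k = E)
    (h1 : ∀ k < K, 1 ≤ h k → 1 ≤ e k) (h2 : ∀ k < K, 2 ≤ h k → c * E ≤ e k) :
    (E : ℝ) ^ n * ∏ k ∈ range K, ((h k).factorial : ℝ) <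
      ((E + K - 1).choose (K - 1) : ℝ) * ((n + K - 1).choose (K - 1) : ℝ) * (n.factorial : ℝ)
        * ∏ k ∈ range K, (e k : ℝ) ^ h k := by
  have hER : (0 : ℝ) < E := by exact_mod_cast hE0
  have hnR : (2 : ℝ) ≤ n := by exact_mod_cast hn2
  have hc1 : c ≤ 1 := by nlinarith
  have hf1 : (1 : ℝ) ≤ (n + 1).factorial := by exact_mod_cast Nat.factorial_pos _
  by_cases hA : ((range K).filter (fun k => h k = 1)).card + 2 ≤ K
  · refine core_caseA n c hc hc1 E hE0 (hE.trans_le ?_) K h e hs h1 h2 hA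
    gcongr ?_ * _
    exact pow_le_pow_of_le_one hc.le hc1 (by omega)
  · have hsum := card_filter_add_card_filter_not (s := range K) (fun k => h k = 1)
    rw [card_range] at hsum
    have hle : ((range K).filter (fun k => ¬ h k = 1)).card ≤ 1 := by omega
    obtain ⟨k0, hk0, ho, hmax⟩ : ∃ k0 < K, (∀ k < K, k ≠ k0 → h k = 1) ∧
        (h k0 = 1 → ∀ k < K, e k ≤ e k0) := by
      by_cases hex : ∃ k0 < K, h k0 ≠ 1
      · obtain ⟨k0, hk0, hk01⟩ := hex
        refine ⟨k0, hk0, ?_, fun hh => absurd hh hk01⟩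
        intro k hk hne
        by_contra hh
        exact hne (card_le_one.1 hle k (by simp [hk, hh]) k0 (by simp [hk0, hk01]))
      · push Not at hex
        obtain ⟨k0, hk0, hm⟩ := exists_max_image (range K) e ⟨0, by simp; omega⟩
        exact ⟨k0, by simpa using hk0, fun k hk _ => hex k hk,
          fun _ k hk => hm k (by simpa using hk)⟩
    exact core_caseB n hn2 c hc hcn E hE0 (hf1.trans_lt hE) K hK2 h e hs he h1 h2 k0 hk0 ho hmax

lemma logStar_one_le (K : ℕ) : logStar 1 ≤ logStar K := by
  unfold logStar
  have h0 : ∀ j : ℕ, max ((fun x => Real.logb 2 x)^[j + 1] ((1 : ℕ) : ℝ)) 0 = 0 := by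
    intro j
    have : (fun x => Real.logb 2 x)^[j + 1] ((1 : ℕ) : ℝ) = 0 := by
      rw [Function.iterate_succ_apply]
      simp only [Nat.cast_one, Real.logb_one]
      exact Function.iterate_fixed (by simp) j
    rw [this, max_self]
  simp only [h0, tsum_zero]
  have := tsum_nonneg (L := SummationFilter.unconditional ℕ) (g := fun j : ℕ => max ((fun x => Real.logb 2 x)^[j + 1] (K : ℝ)) 0)
    (fun j => le_max_right _ _)
  linarith

lemma exists_gap {n : ℕ} (D : Fin n → ℝ) (hD : Function.Injective D) :
    ∃ δ > (0 : ℝ), ∀ i j, i ≠ j → δ ≤ |D i - D j| := by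
  rcases (univ.filter (fun p : Fin n × Fin n => p.1 ≠ p.2)).eq_empty_or_nonempty with h | h
  · refine ⟨1, one_pos, fun i j hij => ?_⟩
    have : (i, j) ∈ univ.filter (fun p : Fin n × Fin n => p.1 ≠ p.2) := by simp [hij]
    rw [h] at this
    simp at this
  · obtain ⟨p, hp, hm⟩ := exists_min_image _ (fun p : Fin n × Fin n => |D p.1 - D p.2|) h
    refine ⟨|D p.1 - D p.2|, ?_, fun i j hij => hm (i, j) (by simp [hij])⟩
    rw [mem_filter] at hp
    exact abs_pos.2 (sub_ne_zero.2 (hD.ne hp.2))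

lemma cEnum_gt {n : ℕ} (hn : 2 ≤ n) (D : Fin n → ℝ) {xmin xmax ε : ℝ} (hε : 0 < ε) {E : ℕ}
    (hE1 : 1 ≤ E)
    (hE : (E : ℝ) = 1 + (xmax - xmin) / ε) (δ c : ℝ) (hδ : ∀ i j, i ≠ j → δ ≤ |D i - D j|)
    (hc : 0 < c) (hcn : c * (2 * n ^ 2) ≤ 1) (hcE : c * (E * ε) ≤ δ)
    (hbig : ((n + 1).factorial : ℝ) < c ^ (n + 1) * E)
    (M : Histogram n ε xmin xmax E) (hM : M.Compatible D) (hK : 2 ≤ M.K) :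
    logStar 1 + n * Real.log E < M.cEnum := by
  classical
  have hER : (0 : ℝ) < E := by exact_mod_cast hE1
  have hg : ∀ k, ∃ t : ℕ, k ≤ M.K → M.c k = xmin - ε / 2 + t * ε := by
    intro k
    by_cases hk : k ≤ M.K
    · obtain ⟨t, -, ht⟩ := M.c_grid k hk
      exact ⟨t, fun _ => ht⟩
    · exact ⟨0, fun h => absurd h hk⟩
  choose t ht using hg
  have htm : ∀ k < M.K, t k ≤ t (k + 1) := by
    intro k hk
    have := M.c_mono k hk
    rw [ht k hk.le, ht (k + 1) hk] at this
    have h3 : (t k : ℝ) ≤ t (k + 1) := le_of_mul_le_mul_right (by linarith) hε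
    exact_mod_cast h3
  set e : ℕ → ℕ := fun k => t (k + 1) - t k with he
  have heR : ∀ k < M.K, (e k : ℝ) = t (k + 1) - t k := fun k hk => by
    simp only [he]; rw [Nat.cast_sub (htm k hk)]
  have hdiff : ∀ k < M.K, M.c (k + 1) - M.c k = e k * ε := by
    intro k hk
    rw [heR k hk, ht k hk.le, ht (k + 1) hk]; ring
  have hsumE : ∑ k ∈ range M.K, e k = E := by
    have : ∑ k ∈ range M.K, (e k : ℝ) * ε = E * ε := by
      rw [sum_congr rfl (fun k hk => (hdiff k (mem_range.1 hk)).symm), sum_range_sub,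
        M.c_first, M.c_last, hE]
      field_simp; ring
    rw [← sum_mul] at this
    exact_mod_cast mul_right_cancel₀ hε.ne' this
  have h1 : ∀ k < M.K, 1 ≤ M.h k → 1 ≤ e k := by
    intro k hk hh
    rw [← hM k hk] at hh
    obtain ⟨i, hi⟩ := card_pos.1 hh
    rw [mem_filter] at hi
    have h4 := hi.2.1.trans_le hi.2.2
    by_contra h5
    have h6 : e k = 0 := by omega
    have := hdiff k hk
    rw [h6] at this
    simp at this
    linarith
  have h2 : ∀ k < M.K, 2 ≤ M.h k → c * E ≤ e k := by
    intro k hk hh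
    rw [← hM k hk] at hh
    obtain ⟨i, hi, j, hj, hij⟩ := one_lt_card.1 hh
    rw [mem_filter] at hi hj
    obtain ⟨-, hi1, hi2⟩ := hi
    obtain ⟨-, hj1, hj2⟩ := hj
    have h4 := hδ i j hij
    have h5 : |D i - D j| ≤ e k * ε := by
      rw [← hdiff k hk, abs_le]
      constructor <;> linarith
    refine le_of_mul_le_mul_right (a := ε) ?_ hε
    linarith
  have hcore := core n hn c hc hcn E (by omega) hbig M.K hK M.h e M.h_sum hsumE h1 h2
  have hpne : ∀ k ∈ range M.K, (e k : ℝ) ^ M.h k ≠ 0 := by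
    intro k hk
    by_cases h0 : M.h k = 0
    · simp [h0]
    · have := h1 k (mem_range.1 hk) (by omega)
      apply pow_ne_zero
      exact_mod_cast (show e k ≠ 0 by omega)
  have hfne : ∀ k ∈ range M.K, ((M.h k).factorial : ℝ) ≠ 0 := by
    intro k _; positivity
  have hA : (((E + M.K - 1).choose (M.K - 1) : ℕ) : ℝ) ≠ 0 := by
    exact_mod_cast (Nat.choose_pos (by omega)).ne'
  have hB : (((n + M.K - 1).choose (M.K - 1) : ℕ) : ℝ) ≠ 0 := by
    exact_mod_cast (Nat.choose_pos (by omega)).ne'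
  have hF : (n.factorial : ℝ) ≠ 0 := by positivity
  have hlog := Real.log_lt_log (by positivity) hcore
  rw [Real.log_mul (by positivity) (prod_ne_zero_iff.2 hfne), Real.log_pow,
    Real.log_mul (mul_ne_zero (mul_ne_zero hA hB) hF) (prod_ne_zero_iff.2 hpne),
    Real.log_mul (mul_ne_zero hA hB) hF, Real.log_mul hA hB, Real.log_prod hfne,
    Real.log_prod hpne] at hlog
  have hl := logStar_one_le M.K
  have hlast : ∑ k ∈ range M.K, (M.h k : ℝ) * Real.log ((M.c (k + 1) - M.c k) / ε)
      = ∑ k ∈ range M.K, Real.log ((e k : ℝ) ^ M.h k) := by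
    apply sum_congr rfl
    intro k hk
    rw [hdiff k (mem_range.1 hk), mul_div_cancel_right₀ _ hε.ne', Real.log_pow]
  unfold Histogram.cEnum
  rw [hlast]
  linarith

/-- for a data set of pairwise distinct observations and ε small
enough, the only optimal histogram is the trivial single-interval one. -/
theorem stmt10 {n : ℕ} (D : Fin n → ℝ) (hn : 2 ≤ n) (hD : Function.Injective D)
    {xmin xmax : ℝ} (hxmin : IsGLB (Set.range D) xmin) (hxmax : IsLUB (Set.range D) xmax) :
    ∃ ε₀ > (0 : ℝ), ∀ ε : ℝ, 0 < ε → ε ≤ ε₀ →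
      ∀ E : ℕ, 1 ≤ E → (E : ℝ) = 1 + (xmax - xmin) / ε →
        ∀ M : Histogram n ε xmin xmax E, M.Optimal D →
          M.K = 1 ∧ M.c 0 = xmin - ε / 2 ∧ M.c 1 = xmax + ε / 2 ∧ M.h 0 = n := by
  classical
  have hlo : ∀ i, xmin ≤ D i := fun i => hxmin.1 ⟨i, rfl⟩
  have hhi : ∀ i, D i ≤ xmax := fun i => hxmax.1 ⟨i, rfl⟩
  have hL : 0 < xmax - xmin := by
    have hne : D ⟨0, by omega⟩ ≠ D ⟨1, by omega⟩ := hD.ne (by simp)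
    rcases lt_or_gt_of_ne hne with h | h
    · linarith [hlo ⟨0, by omega⟩, hhi ⟨1, by omega⟩]
    · linarith [hlo ⟨1, by omega⟩, hhi ⟨0, by omega⟩]
  obtain ⟨δ, hδ0, hδ⟩ := exists_gap D hD
  set L := xmax - xmin with hLdef
  have hnR : (2 : ℝ) ≤ n := by exact_mod_cast hn
  set c := min (1 / (2 * (n : ℝ) ^ 2)) (δ / (1 + L)) with hcdef
  have hc : 0 < c := lt_min (by positivity) (by positivity)
  have hcn : c * (2 * n ^ 2) ≤ 1 := by
    rw [← le_div_iff₀ (by positivity)]; exact min_le_left _ _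
  have hcδ : c * (1 + L) ≤ δ := by
    rw [← le_div_iff₀ (by positivity)]; exact min_le_right _ _
  have hF : (0 : ℝ) < (n + 1).factorial := by positivity
  refine ⟨min 1 (c ^ (n + 1) * L / (n + 1).factorial), lt_min one_pos (by positivity), ?_⟩
  intro ε hε hεle E hE1 hE M hM
  have hε1 : ε ≤ 1 := hεle.trans (min_le_left _ _)
  have hε2 := hεle.trans (min_le_right _ _)
  have hEε : E * ε = ε + L := by rw [hE]; field_simp
  have hbig : ((n + 1).factorial : ℝ) < c ^ (n + 1) * E := by
    rw [le_div_iff₀ hF] at hε2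
    have hcp : 0 < c ^ (n + 1) := by positivity
    refine lt_of_mul_lt_mul_right (a := ε) ?_ hε.le
    rw [mul_assoc, hEε, mul_add]
    nlinarith [mul_pos hcp hε]
  have hcE : c * (E * ε) ≤ δ := by
    rw [hEε]
    refine le_trans ?_ hcδ
    gcongr
  have hK : M.K = 1 := by
    by_contra hne
    have hK2 : 2 ≤ M.K := by have := M.K_pos; omega
    have hgt := cEnum_gt hn D hε hE1 hE δ c hδ hc hcn hcE hbig M hM.1 hK2
    let M0 : Histogram n ε xmin xmax E :=
      { K := 1
        c := fun k => if k = 0 then xmin - ε / 2 else xmax + ε / 2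
        h := fun _ => n
        K_pos := le_refl _
        c_mono := by
          intro k hk
          have : k = 0 := by omega
          subst this
          simp
          linarith
        c_first := by simp
        c_last := by simp
        c_grid := by
          intro k hk
          rcases Nat.eq_zero_or_pos k with h | h
          · exact ⟨0, by omega, by simp [h]⟩
          · refine ⟨E, le_refl _, ?_⟩
            rw [if_neg (by omega), hEε]
            linarith
        h_sum := by simp }
    have hcomp : M0.Compatible D := by
      intro k hk
      have hk1 : k < 1 := hk
      have : k = 0 := by omega
      subst this
      show _ = n
      rw [filter_true_of_mem]
      · simp
      · intro i _
        have a1 := hlo i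
        have a2 := hhi i
        simp only [M0, Set.mem_Ioc]
        constructor
        · simp; linarith
        · simp; linarith
    have hle := hM.2 M0 hcomp
    have hval : M0.cEnum = logStar 1 + n * Real.log E := by
      have hw : (xmax + ε / 2 - (xmin - ε / 2)) / ε = E := by
        rw [div_eq_iff hε.ne', hEε]; ring
      unfold Histogram.cEnum
      simp [M0, hw]
    linarith
  refine ⟨hK, M.c_first, ?_, ?_⟩
  · rw [← M.c_last, hK]
  · have := M.h_sum
    rw [hK] at this
    simpa using this
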